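/- Let C₁, …, C_L be positive semi-definite complex matrices of the same size, let 1 ≤ q ≤ p be reals, and let V_{C_1}, …, V_{C_L} be any fixed unitary matrices with V_{C_i} commuting with C_i for each i. Then ‖C₁^{1/p} V_{C_1} ⋯ C_L^{1/p} V_{C_L}‖_p^p ≤ max_{W_{C_1},…,W_{C_L}} ‖C₁^{1/q} W_{C_1} ⋯ C_L^{1/q} W_{C_L}‖_q^q, where the maximum is over all unitaries W_{C_i} commuting with C_i. -/

import Mathlib

noncomputable section

open Matrix
open scoped ENNReal ComplexOrder

/-- Functional calculus of a Hermitian complex matrix applied with a complex-valued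
function of its (real) eigenvalues. Returns `0` if the matrix is not Hermitian. -/
def hermFC {n : Type*} [Fintype n] [DecidableEq n] (A : Matrix n n ℂ) (f : ℝ → ℂ) :
    Matrix n n ℂ :=
  if hA : A.IsHermitian then
    (hA.eigenvectorUnitary : Matrix n n ℂ) * Matrix.diagonal (f ∘ hA.eigenvalues) *
      (star hA.eigenvectorUnitary : Matrix n n ℂ)
  else 0

/-- Complex power `A ^ z` of a positive semi-definite matrix, defined by functional
calculus on eigenvalues, with eigenvalue `0` mapped to `0`. -/
def mpow {n : Type*} [Fintype n] [DecidableEq n] (A : Matrix n n ℂ) (z : ℂ) :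
    Matrix n n ℂ :=
  hermFC A (fun x => if x = 0 then 0 else (x : ℂ) ^ z)

/-- The Schatten `p`-norm `(Tr |X|^p)^(1/p)` of a complex matrix, where
`|X|^p = (Xᴴ X)^(p/2)` is given by functional calculus. -/
def schattenNorm {n : Type*} [Fintype n] [DecidableEq n] (p : ℝ) (X : Matrix n n ℂ) : ℝ :=
  ((mpow (Xᴴ * X) ((p / 2 : ℝ) : ℂ)).trace).re ^ (1 / p)

/-- The operator norm (largest singular value) of a complex matrix. -/
def opNorm {n : Type*} [Fintype n] [DecidableEq n] (X : Matrix n n ℂ) : ℝ :=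
  ‖Matrix.toEuclideanCLM (𝕜 := ℂ) X‖

/-- Schatten norm with exponent in `[1,∞]`: the operator norm when `p = ∞`. -/
def schattenNormE {n : Type*} [Fintype n] [DecidableEq n] (p : ℝ≥0∞) (X : Matrix n n ℂ) :
    ℝ :=
  if p = ⊤ then opNorm X else schattenNorm p.toReal X

/-- Matrix logarithm of a Hermitian matrix via functional calculus. -/
def mlog {n : Type*} [Fintype n] [DecidableEq n] (A : Matrix n n ℂ) : Matrix n n ℂ :=
  hermFC A (fun x => ((Real.log x : ℝ) : ℂ))

/-- Matrix exponential of a Hermitian matrix via functional calculus. -/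
def mexp {n : Type*} [Fintype n] [DecidableEq n] (A : Matrix n n ℂ) : Matrix n n ℂ :=
  hermFC A (fun x => ((Real.exp x : ℝ) : ℂ))

/-- `α_θ(t) = sin(πθ)/(2(1-θ)[cosh(πt) - cos(πθ)])`. -/
def alphaW (θ t : ℝ) : ℝ :=
  Real.sin (Real.pi * θ) / (2 * (1 - θ) * (Real.cosh (Real.pi * t) - Real.cos (Real.pi * θ)))

/-- `β_θ(t) = sin(πθ)/(2θ[cosh(πt) + cos(πθ)])`. -/
def betaW (θ t : ℝ) : ℝ :=
  Real.sin (Real.pi * θ) / (2 * θ * (Real.cosh (Real.pi * t) + Real.cos (Real.pi * θ)))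

/-- `β₀(t) = π/(2[cosh(πt) + 1])`. -/
def betaZero (t : ℝ) : ℝ := Real.pi / (2 * (Real.cosh (Real.pi * t) + 1))

section SchattenInterpolation

open scoped Matrix.Norms.L2Operator

variable {n : Type*} [Fintype n] [DecidableEq n]

/-- The complex power of a real number in the convention of `mpow`: `0` is sent to `0`. -/
def zeroPow (x : ℝ) (z : ℂ) : ℂ := if x = 0 then 0 else (x : ℂ) ^ z

lemma exists_unitary_diagonal_mpow {C : Matrix n n ℂ} (hC : C.PosSemidef) :
    ∃ Q ∈ Matrix.unitaryGroup n ℂ, ∃ x : n → ℝ, (∀ i, 0 ≤ x i) ∧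
      C = Q * diagonal (fun i => (x i : ℂ)) * star Q ∧
      ∀ z, mpow C z = Q * diagonal (fun i => zeroPow (x i) z) * star Q := by
  refine ⟨hC.1.eigenvectorUnitary, hC.1.eigenvectorUnitary.2, hC.1.eigenvalues,
    hC.eigenvalues_nonneg, ?_, fun z => ?_⟩
  · exact hC.1.spectral_theorem
  · rw [mpow, hermFC, dif_pos hC.1]
    rfl

lemma norm_zeroPow_le {x : ℝ} (hx : 0 ≤ x) (z : ℂ) : ‖zeroPow x z‖ ≤ x ^ z.re := by
  unfold zeroPow
  split_ifs with h
  · simpa using Real.rpow_nonneg hx _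
  · rw [Complex.norm_cpow_eq_rpow_re_of_pos (lt_of_le_of_ne hx (Ne.symm h))]

lemma zeroPow_ofReal {x : ℝ} (hx : 0 ≤ x) {r : ℝ} (hr : r ≠ 0) :
    zeroPow x r = ((x ^ r : ℝ) : ℂ) := by
  unfold zeroPow
  split_ifs with h
  · simp [h, Real.zero_rpow hr]
  · rw [Complex.ofReal_cpow hx]

lemma differentiable_zeroPow (x : ℝ) : Differentiable ℂ (zeroPow x) := by
  unfold zeroPow
  split_ifs with h
  · fun_prop
  · intro z
    exact (differentiableAt_id).const_cpow (Or.inl (by exact_mod_cast h))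

lemma norm_apply_le_l2_opNorm (A : Matrix n n ℂ) (i j : n) : ‖A i j‖ ≤ ‖A‖ := by
  have h := A.l2_opNorm_mulVec (EuclideanSpace.single j 1)
  have h2 := PiLp.norm_apply_le ((EuclideanSpace.equiv n ℂ).symm
    (A *ᵥ (EuclideanSpace.single j (1 : ℂ)).ofLp)) i
  simp at h h2
  exact h2.trans h

lemma l2_opNorm_le_one_of_mem_unitaryGroup {U : Matrix n n ℂ}
    (hU : U ∈ Matrix.unitaryGroup n ℂ) : ‖U‖ ≤ 1 := by
  have h : star U * U = 1 := hU.1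
  have h1 : ‖(1 : Matrix n n ℂ)‖ ≤ 1 := by
    rw [← Matrix.diagonal_one, Matrix.l2_opNorm_diagonal]
    exact (pi_norm_le_iff_of_nonneg zero_le_one).2 fun i => by simp
  rw [← h, CStarRing.norm_star_mul_self] at h1
  nlinarith [norm_nonneg U]

lemma norm_unitary_conj_le {P R : Matrix n n ℂ} (hP : P ∈ Matrix.unitaryGroup n ℂ)
    (hR : R ∈ Matrix.unitaryGroup n ℂ) (A : Matrix n n ℂ) : ‖P * A * R‖ ≤ ‖A‖ :=
  calc ‖P * A * R‖ ≤ ‖P‖ * ‖A‖ * ‖R‖ :=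
        (norm_mul_le _ _).trans (mul_le_mul_of_nonneg_right (norm_mul_le _ _) (norm_nonneg _))
    _ ≤ 1 * ‖A‖ * 1 := by
        gcongr
        · exact l2_opNorm_le_one_of_mem_unitaryGroup hP
        · exact l2_opNorm_le_one_of_mem_unitaryGroup hR
    _ = ‖A‖ := by ring

lemma exists_unitary_mul_eq_diagonal_sqrt {Y : Matrix n n ℂ} {x : n → ℝ} (hx : ∀ i, 0 ≤ x i)
    (hY : star Y * Y = diagonal (fun i => (x i : ℂ))) :
    ∃ A ∈ Matrix.unitaryGroup n ℂ, A * Y = diagonal (fun i => ((√(x i) : ℝ) : ℂ)) := by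
  have hY' : ∀ j k, ∑ i, star (Y i j) * Y i k = if j = k then (x j : ℂ) else 0 := by
    intro j k
    have := congrFun (congrFun hY j) k
    rwa [Matrix.mul_apply, Matrix.diagonal_apply] at this
  let w : n → EuclideanSpace ℂ n := fun k => WithLp.toLp 2 (fun i => ((√(x k) : ℂ))⁻¹ * Y i k)
  have hw : Orthonormal ℂ (Set.domRestrict {k | x k ≠ 0} w) := by
    rw [orthonormal_iff_ite]
    rintro ⟨j, hj⟩ ⟨k, hk⟩
    have : inner ℂ (w j) (w k) = ((√(x j) : ℂ))⁻¹ * ((√(x k) : ℂ))⁻¹ * ∑ i, star (Y i j) * Y i k := by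
      simp only [w, PiLp.inner_apply, RCLike.inner_apply, Finset.mul_sum]
      refine Finset.sum_congr rfl fun i _ => ?_
      simp
      ring
    simp only [Set.domRestrict_apply, this, hY', Subtype.mk.injEq]
    split_ifs with h
    · subst h
      have h0 : (√(x j) : ℂ) ≠ 0 := by
        simpa [Real.sqrt_eq_zero (hx j)] using hj
      have h2 : (x j : ℂ) = (√(x j) : ℂ) * √(x j) := by
        rw [← Complex.ofReal_mul, Real.mul_self_sqrt (hx j)]
      rw [h2]
      field_simp
    · simp
  obtain ⟨a, ha⟩ := hw.exists_orthonormalBasis_extension_of_card_eq (by simp)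
  have hYa : ∀ i k, Y i k = (√(x k) : ℂ) * a k i := by
    intro i k
    by_cases hk : x k = 0
    · have h0 := hY' k k
      rw [if_pos rfl, hk] at h0
      have h1 : ∑ i, ‖Y i k‖ ^ 2 = 0 := by
        have : ((∑ i, ‖Y i k‖ ^ 2 : ℝ) : ℂ) = 0 := by
          rw [← Complex.ofReal_zero, ← h0]
          push_cast
          refine Finset.sum_congr rfl fun i _ => ?_
          exact (Complex.conj_mul' _).symm
        exact_mod_cast this
      rw [Finset.sum_eq_zero_iff_of_nonneg (fun i _ => by positivity)] at h1
      have := h1 i (Finset.mem_univ _)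
      simp [hk]
      simpa using this
    · rw [ha k hk]
      have h0 : (√(x k) : ℂ) ≠ 0 := by
        simpa [Real.sqrt_eq_zero (hx k)] using hk
      simp only [w]
      field_simp
  have haa : ∀ j k, ∑ i, star (a j i) * a k i = if j = k then 1 else 0 := by
    intro j k
    rw [← orthonormal_iff_ite.1 a.orthonormal j k]
    simp [PiLp.inner_apply, mul_comm]
  refine ⟨Matrix.of fun k i => star (a k i), ?_, ?_⟩
  · rw [Matrix.mem_unitaryGroup_iff]
    ext j k
    simpa [Matrix.mul_apply, Matrix.one_apply] using haa j k
  · ext j k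
    have : ∑ i, star (a j i) * Y i k = (√(x k) : ℂ) * ∑ i, star (a j i) * a k i := by
      rw [Finset.mul_sum]
      refine Finset.sum_congr rfl fun i _ => ?_
      rw [hYa]
      ring
    rw [Matrix.mul_apply, Matrix.diagonal_apply]
    simp only [Matrix.of_apply]
    rw [this, haa]
    split_ifs with h <;> simp [h]

/-- Singular value decomposition, together with the Schatten norms in terms of the
singular values. -/
lemma exists_singularValues (X : Matrix n n ℂ) :
    ∃ A ∈ Matrix.unitaryGroup n ℂ, ∃ B ∈ Matrix.unitaryGroup n ℂ, ∃ s : n → ℝ,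
      (∀ i, 0 ≤ s i) ∧ A * X * B = diagonal (fun i => (s i : ℂ)) ∧
      ∀ p : ℝ, 1 ≤ p → schattenNorm p X ^ p = ∑ i, s i ^ p := by
  obtain ⟨Q, hQ, x, hx, hXX, hpow⟩ :=
    exists_unitary_diagonal_mpow (posSemidef_conjTranspose_mul_self X)
  have hQQ : star Q * Q = 1 := hQ.1
  obtain ⟨A, hA, hAX⟩ := exists_unitary_mul_eq_diagonal_sqrt (Y := X * Q) hx (by
    rw [star_mul]
    calc star Q * star X * (X * Q) = star Q * (Xᴴ * X) * Q := by
          rw [star_eq_conjTranspose X]; noncomm_ring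
      _ = (star Q * Q) * diagonal (fun i => (x i : ℂ)) * (star Q * Q) := by
          rw [hXX]; noncomm_ring
      _ = _ := by rw [hQQ]; simp)
  refine ⟨A, hA, Q, hQ, fun i => √(x i), fun i => Real.sqrt_nonneg _, ?_, fun p hp => ?_⟩
  · rw [← hAX, mul_assoc]
  · have h : (mpow (Xᴴ * X) ((p / 2 : ℝ) : ℂ)).trace = ((∑ i, √(x i) ^ p : ℝ) : ℂ) := by
      rw [hpow, Matrix.trace_mul_comm, ← mul_assoc, hQQ, one_mul, Matrix.trace_diagonal]
      rw [Complex.ofReal_sum]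
      refine Finset.sum_congr rfl fun i _ => ?_
      rw [zeroPow_ofReal (hx i) (by positivity), Real.sqrt_eq_rpow, ← Real.rpow_mul (hx i)]
      congr 2
      ring
    rw [schattenNorm, h, Complex.ofReal_re, ← Real.rpow_mul, one_div,
      inv_mul_cancel₀ (by positivity), Real.rpow_one]
    exact Finset.sum_nonneg fun i _ => Real.rpow_nonneg (Real.sqrt_nonneg _) _

lemma sum_norm_sq_row_of_mem_unitaryGroup {U : Matrix n n ℂ}
    (hU : U ∈ Matrix.unitaryGroup n ℂ) (j : n) : ∑ k, ‖U j k‖ ^ 2 = 1 := by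
  have h := congrFun (congrFun (Matrix.mem_unitaryGroup_iff.1 hU) j) j
  rw [Matrix.mul_apply, Matrix.one_apply_eq] at h
  have h' : ((∑ k, ‖U j k‖ ^ 2 : ℝ) : ℂ) = 1 := by
    rw [← h]
    push_cast
    exact Finset.sum_congr rfl fun k _ => (Complex.mul_conj' _).symm
  exact_mod_cast h'

lemma sum_norm_sq_col_of_mem_unitaryGroup {U : Matrix n n ℂ}
    (hU : U ∈ Matrix.unitaryGroup n ℂ) (k : n) : ∑ j, ‖U j k‖ ^ 2 = 1 := by
  have h := sum_norm_sq_row_of_mem_unitaryGroup (Unitary.star_mem hU) k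
  simpa [Matrix.star_apply] using h

/-- The `ℓ^q` norm of the diagonal of a matrix in any pair of orthonormal bases is at most
its Schatten `q`-norm. -/
lemma sum_norm_diag_rpow_le {P R : Matrix n n ℂ} (hP : P ∈ Matrix.unitaryGroup n ℂ)
    (hR : R ∈ Matrix.unitaryGroup n ℂ) (X : Matrix n n ℂ) {q : ℝ} (hq : 1 ≤ q) :
    ∑ j, ‖(P * X * R) j j‖ ^ q ≤ schattenNorm q X ^ q := by
  obtain ⟨A, hA, B, hB, s, hs, hX, hsch⟩ := exists_singularValues X
  rw [hsch q hq]
  have hM : P * star A ∈ Matrix.unitaryGroup n ℂ := mul_mem hP (Unitary.star_mem hA)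
  have hN : star B * R ∈ Matrix.unitaryGroup n ℂ := mul_mem (Unitary.star_mem hB) hR
  set M := P * star A with hMdef
  set N := star B * R with hNdef
  have hPXR : P * X * R = M * diagonal (fun i => (s i : ℂ)) * N := by
    have hAA : star A * A = 1 := hA.1
    have hBB : B * star B = 1 := hB.2
    calc P * X * R = P * (star A * A) * X * (B * star B) * R := by rw [hAA, hBB]; simp
      _ = M * (A * X * B) * N := by rw [hMdef, hNdef]; noncomm_ring
      _ = _ := by rw [hX]
  let w : n → n → ℝ := fun j k => (‖M j k‖ ^ 2 + ‖N k j‖ ^ 2) / 2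
  have hw0 : ∀ j k, 0 ≤ w j k := fun j k => by positivity
  have hw1 : ∀ j, ∑ k, w j k = 1 := fun j => by
    simp only [w, ← Finset.sum_div, Finset.sum_add_distrib]
    rw [sum_norm_sq_row_of_mem_unitaryGroup hM, sum_norm_sq_col_of_mem_unitaryGroup hN]
    norm_num
  have hw2 : ∀ k, ∑ j, w j k = 1 := fun k => by
    simp only [w, ← Finset.sum_div, Finset.sum_add_distrib]
    rw [sum_norm_sq_row_of_mem_unitaryGroup hN, sum_norm_sq_col_of_mem_unitaryGroup hM]
    norm_num
  have hentry : ∀ j, ‖(P * X * R) j j‖ ≤ ∑ k, w j k * s k := fun j => by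
    rw [hPXR, Matrix.mul_apply]
    refine (norm_sum_le _ _).trans (Finset.sum_le_sum fun k _ => ?_)
    rw [Matrix.mul_diagonal, norm_mul, norm_mul, Complex.norm_real, Real.norm_of_nonneg (hs k)]
    have h2 : ‖M j k‖ * ‖N k j‖ ≤ w j k := by
      simp only [w]
      nlinarith [sq_nonneg (‖M j k‖ - ‖N k j‖)]
    nlinarith [mul_le_mul_of_nonneg_right h2 (hs k)]
  calc ∑ j, ‖(P * X * R) j j‖ ^ q ≤ ∑ j, ∑ k, w j k * s k ^ q := by
        refine Finset.sum_le_sum fun j _ => ?_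
        refine (Real.rpow_le_rpow (norm_nonneg _) (hentry j) (by linarith)).trans ?_
        exact Real.rpow_arith_mean_le_arith_mean_rpow _ _ _ (fun k _ => hw0 j k) (hw1 j)
          (fun k _ => hs k) hq
    _ = ∑ k, s k ^ q := by
        rw [Finset.sum_comm]
        refine Finset.sum_congr rfl fun k _ => ?_
        rw [← Finset.sum_mul, hw2, one_mul]

/-- Hölder's inequality with exponents `q` and `q / (q - 1)`, including `q = 1`. -/
lemma sum_rpow_mul_le {ι : Type*} [Fintype ι] {s g : ι → ℝ} (hs : ∀ i, 0 ≤ s i) (hg : ∀ i, 0 ≤ g i)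
    {p q : ℝ} (hq : 1 ≤ q) :
    ∑ i, s i ^ (p - p / q) * g i ≤
      (∑ i, s i ^ p) ^ (1 - 1 / q) * (∑ i, g i ^ q) ^ (1 / q) := by
  rcases hq.eq_or_lt with rfl | hq1
  · simp
  have hc : (q.conjExponent).HolderConjugate q := (Real.HolderConjugate.conjExponent hq1).symm
  have hq0 : q ≠ 0 := by positivity
  have hq2 : q - 1 ≠ 0 := by linarith
  convert Real.inner_le_Lp_mul_Lq_of_nonneg Finset.univ hc
    (fun i _ => Real.rpow_nonneg (hs i) (p - p / q)) (fun i _ => hg i) using 3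
  · refine Finset.sum_congr rfl fun i _ => ?_
    rw [← Real.rpow_mul (hs i), Real.conjExponent]
    congr 1
    field_simp
  · rw [Real.conjExponent]
    field_simp

lemma le_of_le_rpow_mul_rpow {T M p q : ℝ} (hT : 0 ≤ T) (hM : 0 ≤ M) (hq : 0 < q) (hp : 0 < p)
    (h : T ≤ T ^ (1 - q / p) * (T ^ (1 - 1 / q) * M ^ (1 / q)) ^ (q / p)) : T ≤ M := by
  rcases hT.eq_or_lt with rfl | hT0
  · exact hM
  have h1 : T ^ (1 - q / p) * (T ^ (1 - 1 / q) * M ^ (1 / q)) ^ (q / p) =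
      T ^ (1 - 1 / p) * M ^ (1 / p) := by
    rw [Real.mul_rpow (by positivity) (by positivity), ← Real.rpow_mul hT, ← Real.rpow_mul hM,
      ← mul_assoc, ← Real.rpow_add hT0]
    congr 2 <;> field_simp
    ring
  have h2 : T = T ^ (1 - 1 / p) * T ^ (1 / p) := by
    rw [← Real.rpow_add hT0]
    simp
  rw [h1] at h
  nth_rewrite 1 [h2] at h
  have h3 := le_of_mul_le_mul_left h (Real.rpow_pos_of_pos hT0 _)
  exact (Real.rpow_le_rpow_iff hT hM (by positivity)).1 h3

open Complex.HadamardThreeLines in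
/-- Stein–Hirschman type interpolation between the operator norm and the Schatten
`q`-norm. -/
lemma schattenNorm_rpow_le_of_strip {G : ℂ → Matrix n n ℂ} (hG : Differentiable ℂ G)
    {K : ℝ} (hK : ∀ z : ℂ, 0 ≤ z.re → z.re ≤ 1 → ‖G z‖ ≤ K)
    (h0 : ∀ z : ℂ, z.re = 0 → ‖G z‖ ≤ 1) {p q : ℝ} (hq : 1 ≤ q) (hqp : q ≤ p) {M : ℝ}
    (h1 : ∀ z : ℂ, z.re = 1 → schattenNorm q (G z) ^ q ≤ M) (hM : 0 ≤ M) :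
    schattenNorm p (G ((q / p : ℝ) : ℂ)) ^ p ≤ M := by
  obtain ⟨A, hA, B, hB, s, hs, hX, hsch⟩ := exists_singularValues (G ((q / p : ℝ) : ℂ))
  have hq0 : 0 < q := by linarith
  have hp0 : 0 < p := by linarith
  rw [hsch p (hq.trans hqp)]
  have hT : 0 ≤ ∑ i, s i ^ p := Finset.sum_nonneg fun i _ => Real.rpow_nonneg (hs i) _
  let F : ℂ → ℂ := fun z => ∑ k, zeroPow (s k) (p * (1 - z / q)) * (A * G z * B) k k
  have hre : ∀ z : ℂ, ((p : ℂ) * (1 - z / q)).re = p - p / q * z.re := fun z => by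
    rw [Complex.re_ofReal_mul, Complex.sub_re, Complex.div_ofReal_re, Complex.one_re]
    ring
  have hF : ∀ z, ‖F z‖ ≤ ∑ k, s k ^ (p - p / q * z.re) * ‖(A * G z * B) k k‖ := fun z => by
    refine (norm_sum_le _ _).trans (Finset.sum_le_sum fun k _ => ?_)
    rw [norm_mul, ← hre]
    exact mul_le_mul_of_nonneg_right (norm_zeroPow_le (hs k) _) (norm_nonneg _)
  have hentry : ∀ z k, ‖(A * G z * B) k k‖ ≤ ‖G z‖ := fun z k =>
    (norm_apply_le_l2_opNorm _ _ _).trans (norm_unitary_conj_le hA hB _)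
  have hdiff : Differentiable ℂ F := by
    refine Differentiable.fun_sum fun k _ => Differentiable.fun_mul ?_ ?_
    · exact (differentiable_zeroPow (s k)).comp (by fun_prop)
    · have hAGB : Differentiable ℂ fun z => A * G z * B :=
        ((differentiable_const A).mul hG).mul (differentiable_const B)
      exact (LinearMap.toContinuousLinearMap
        (Matrix.entryLinearMap ℂ ℂ k k)).differentiable.comp hAGB
  have hbdd : BddAbove ((norm ∘ F) '' verticalClosedStrip 0 1) := by
    refine ⟨∑ k, (1 + s k) ^ p * K, ?_⟩
    rintro _ ⟨z, hz, rfl⟩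
    obtain ⟨hz0, hz1⟩ : 0 ≤ z.re ∧ z.re ≤ 1 := hz
    refine (hF z).trans (Finset.sum_le_sum fun k _ => ?_)
    have hpq : p / q * z.re ≤ p := by
      have : p / q ≤ p := div_le_self hp0.le hq
      nlinarith
    have hpq0 : 0 ≤ p / q * z.re := by positivity
    refine mul_le_mul ?_ ((hentry z k).trans (hK z hz0 hz1)) (norm_nonneg _)
      (Real.rpow_nonneg (by linarith [hs k]) _)
    exact (Real.rpow_le_rpow (hs k) (by linarith) (by linarith)).trans
      (Real.rpow_le_rpow_of_exponent_le (by linarith [hs k]) (by linarith))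
  have hθ : F ((q / p : ℝ) : ℂ) = ((∑ i, s i ^ p : ℝ) : ℂ) := by
    rw [Complex.ofReal_sum]
    refine Finset.sum_congr rfl fun k _ => ?_
    have hexp : (p : ℂ) * (1 - ((q / p : ℝ) : ℂ) / q) = ((p - 1 : ℝ) : ℂ) := by
      have : (p : ℂ) ≠ 0 := by exact_mod_cast hp0.ne'
      have : (q : ℂ) ≠ 0 := by exact_mod_cast hq0.ne'
      push_cast
      field_simp
    rw [hX, Matrix.diagonal_apply_eq, hexp]
    rcases (hs k).eq_or_lt with h | h
    · simp [← h, Real.zero_rpow hp0.ne']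
    · rw [zeroPow, if_neg h.ne', ← Complex.ofReal_cpow h.le, ← Complex.ofReal_mul,
        Real.rpow_sub_one h.ne', div_mul_cancel₀ _ h.ne']
  have hleft : ∀ z ∈ Complex.re ⁻¹' {0}, ‖F z‖ ≤ ∑ i, s i ^ p := by
    intro z hz
    have hz : z.re = 0 := hz
    refine (hF z).trans (Finset.sum_le_sum fun k _ => ?_)
    rw [hz, mul_zero, sub_zero]
    exact mul_le_of_le_one_right (Real.rpow_nonneg (hs k) _) ((hentry z k).trans (h0 z hz))
  have hright : ∀ z ∈ Complex.re ⁻¹' {1},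
      ‖F z‖ ≤ (∑ i, s i ^ p) ^ (1 - 1 / q) * M ^ (1 / q) := by
    intro z hz
    have hz : z.re = 1 := hz
    refine (hF z).trans ?_
    rw [hz, mul_one]
    refine (sum_rpow_mul_le hs (fun k => norm_nonneg _) hq).trans ?_
    refine mul_le_mul_of_nonneg_left ?_ (Real.rpow_nonneg hT _)
    refine Real.rpow_le_rpow (Finset.sum_nonneg fun k _ => Real.rpow_nonneg (norm_nonneg _) _) ?_
      (by positivity)
    exact (sum_norm_diag_rpow_le hA hB _ hq).trans (h1 z hz)
  have hmem : ((q / p : ℝ) : ℂ) ∈ verticalClosedStrip 0 1 := by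
    refine ⟨?_, ?_⟩
    · rw [Complex.ofReal_re]; positivity
    · rw [Complex.ofReal_re]; exact (div_le_one hp0).2 hqp
  have key := norm_le_interp_of_mem_verticalClosedStrip₀₁' F hmem hdiff.diffContOnCl hbdd
    hleft hright
  rw [hθ, Complex.norm_real, Real.norm_of_nonneg hT, Complex.ofReal_re] at key
  exact le_of_le_rpow_mul_rpow hT hM hq0 hp0 key

lemma norm_mpow_le {C : Matrix n n ℂ} (hC : C.PosSemidef) :
    ∃ K, ∀ z : ℂ, 0 ≤ z.re → z.re ≤ 1 → ‖mpow C z‖ ≤ K := by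
  obtain ⟨Q, hQ, x, hx, -, hpow⟩ := exists_unitary_diagonal_mpow hC
  refine ⟨∑ i, (1 + x i), fun z h0 h1 => ?_⟩
  rw [hpow]
  refine (norm_unitary_conj_le hQ (Unitary.star_mem hQ) _).trans ?_
  have hx1 : ∀ i, 0 ≤ 1 + x i := fun i => by linarith [hx i]
  rw [Matrix.l2_opNorm_diagonal, pi_norm_le_iff_of_nonneg (Finset.sum_nonneg fun i _ => hx1 i)]
  intro i
  calc ‖zeroPow (x i) z‖ ≤ x i ^ z.re := norm_zeroPow_le (hx i) z
    _ ≤ (1 + x i) ^ z.re := Real.rpow_le_rpow (hx i) (by linarith) h0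
    _ ≤ (1 + x i) ^ (1 : ℝ) := Real.rpow_le_rpow_of_exponent_le (by linarith [hx i]) h1
    _ = 1 + x i := Real.rpow_one _
    _ ≤ _ := Finset.single_le_sum (f := fun i => 1 + x i) (fun i _ => hx1 i) (Finset.mem_univ i)

lemma norm_mpow_le_one {C : Matrix n n ℂ} (hC : C.PosSemidef) {z : ℂ} (hz : z.re = 0) :
    ‖mpow C z‖ ≤ 1 := by
  obtain ⟨Q, hQ, x, hx, -, hpow⟩ := exists_unitary_diagonal_mpow hC
  rw [hpow]
  refine (norm_unitary_conj_le hQ (Unitary.star_mem hQ) _).trans ?_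
  rw [Matrix.l2_opNorm_diagonal, pi_norm_le_iff_of_nonneg zero_le_one]
  exact fun i => (norm_zeroPow_le (hx i) z).trans (by rw [hz, Real.rpow_zero])

lemma differentiable_mpow {C : Matrix n n ℂ} (hC : C.PosSemidef) :
    Differentiable ℂ (mpow C) := by
  obtain ⟨Q, hQ, x, hx, -, hpow⟩ := exists_unitary_diagonal_mpow hC
  rw [funext hpow]
  have hd : Differentiable ℂ fun z => fun i => zeroPow (x i) z :=
    differentiable_pi.2 fun i => differentiable_zeroPow (x i)
  have hdiag : Differentiable ℂ fun z => diagonal fun i => zeroPow (x i) z :=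
    (LinearMap.toContinuousLinearMap
      (Matrix.diagonalLinearMap n ℂ ℂ)).differentiable.comp hd
  exact ((differentiable_const Q).mul hdiag).mul (differentiable_const _)

/-- The imaginary part of the exponent contributes a unitary factor commuting with the
matrix. -/
lemma exists_unitary_mpow_eq {C : Matrix n n ℂ} (hC : C.PosSemidef) (z : ℂ) :
    ∃ U ∈ Matrix.unitaryGroup n ℂ, U * C = C * U ∧ mpow C z = mpow C (z.re : ℂ) * U := by
  obtain ⟨Q, hQ, x, hx, hCQ, hpow⟩ := exists_unitary_diagonal_mpow hC
  have hQQ : star Q * Q = 1 := hQ.1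
  have hmul : ∀ d e : n → ℂ, Q * diagonal d * star Q * (Q * diagonal e * star Q) =
      Q * diagonal (fun i => d i * e i) * star Q := fun d e => by
    calc _ = Q * diagonal d * (star Q * Q) * diagonal e * star Q := by noncomm_ring
      _ = _ := by rw [hQQ, mul_one, mul_assoc Q, Matrix.diagonal_mul_diagonal]
  let u : n → ℂ := fun i => if x i = 0 then 1 else (x i : ℂ) ^ ((z.im : ℂ) * Complex.I)
  have hu : ∀ i, u i * star (u i) = 1 := fun i => by
    have h : ‖u i‖ = 1 := by
      simp only [u]
      split_ifs with h
      · simp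
      · rw [Complex.norm_cpow_eq_rpow_re_of_pos (lt_of_le_of_ne (hx i) (Ne.symm h))]
        simp
    have := Complex.mul_conj' (u i)
    rw [h] at this
    simpa using this
  refine ⟨Q * diagonal u * star Q, ?_, ?_, ?_⟩
  · rw [Matrix.mem_unitaryGroup_iff]
    have : star (Q * diagonal u * star Q) = Q * diagonal (star u) * star Q := by
      rw [star_mul, star_mul, star_star, star_eq_conjTranspose (diagonal u),
        Matrix.diagonal_conjTranspose, mul_assoc]
    rw [this, hmul]
    simp only [Pi.star_apply, hu]
    rw [Matrix.diagonal_one, mul_one]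
    exact hQ.2
  · rw [hCQ, hmul, hmul]
    simp only [mul_comm]
  · rw [hpow, hpow, hmul]
    congr 3
    funext i
    simp only [zeroPow, u]
    split_ifs with h
    · simp
    · rw [← Complex.cpow_add _ _ (by exact_mod_cast h), Complex.re_add_im]

lemma norm_list_ofFn_prod_le {L : ℕ} {f : Fin L → Matrix n n ℂ} {K : Fin L → ℝ}
    (h : ∀ i, ‖f i‖ ≤ K i) : ‖(List.ofFn f).prod‖ ≤ ∏ i, K i := by
  induction L with
  | zero => simpa using l2_opNorm_le_one_of_mem_unitaryGroup (n := n) (one_mem _)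
  | succ L ih =>
    rw [List.ofFn_succ, List.prod_cons, Fin.prod_univ_succ]
    exact (norm_mul_le _ _).trans (mul_le_mul (h 0) (ih fun i => h i.succ) (norm_nonneg _)
      ((norm_nonneg _).trans (h 0)))

lemma differentiable_list_ofFn_prod {L : ℕ} {f : Fin L → ℂ → Matrix n n ℂ}
    (h : ∀ i, Differentiable ℂ (f i)) :
    Differentiable ℂ fun z => (List.ofFn fun i => f i z).prod := by
  induction L with
  | zero => simp
  | succ L ih =>
    simp only [List.ofFn_succ, List.prod_cons]
    exact (h 0).mul (ih fun i => h i.succ)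

lemma schattenNorm_rpow_nonneg (X : Matrix n n ℂ) {q : ℝ} (hq : 1 ≤ q) :
    0 ≤ schattenNorm q X ^ q := by
  obtain ⟨-, -, -, -, s, hs, -, h⟩ := exists_singularValues X
  rw [h q hq]
  exact Finset.sum_nonneg fun i _ => Real.rpow_nonneg (hs i) _

lemma schattenNorm_rpow_le_card_mul (X : Matrix n n ℂ) {q : ℝ} (hq : 1 ≤ q) :
    schattenNorm q X ^ q ≤ Fintype.card n * ‖X‖ ^ q := by
  obtain ⟨A, hA, B, hB, s, hs, hX, h⟩ := exists_singularValues X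
  rw [h q hq, ← nsmul_eq_mul, ← Finset.card_univ]
  refine Finset.sum_le_card_nsmul _ _ _ fun i _ => ?_
  refine Real.rpow_le_rpow (hs i) ?_ (by linarith)
  have h1 := norm_apply_le_l2_opNorm (A * X * B) i i
  rw [hX, Matrix.diagonal_apply_eq, Complex.norm_real, Real.norm_of_nonneg (hs i), ← hX] at h1
  exact h1.trans (norm_unitary_conj_le hA hB X)

lemma norm_mul_unitary_le {V : Matrix n n ℂ} (hV : V ∈ Matrix.unitaryGroup n ℂ)
    (A : Matrix n n ℂ) : ‖A * V‖ ≤ ‖A‖ := by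
  simpa using norm_unitary_conj_le (one_mem _) hV A

end SchattenInterpolation

/-- For positive semi-definite matrices `C₁, …, C_L`, fixed unitaries
`V_{C_i}` commuting with `C_i`, and reals `1 ≤ q ≤ p`,
`‖C₁^{1/p} V_{C₁} ⋯ C_L^{1/p} V_{C_L}‖_p^p` is bounded by the maximum over unitaries
`W_{C_i}` commuting with `C_i` of `‖C₁^{1/q} W_{C₁} ⋯ C_L^{1/q} W_{C_L}‖_q^q`. -/
theorem schatten_p_power_chain_le_max
    {n : Type*} [Fintype n] [DecidableEq n] (L : ℕ)
    (C V : Fin L → Matrix n n ℂ) (hC : ∀ i, (C i).PosSemidef)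
    (hV : ∀ i, V i ∈ Matrix.unitaryGroup n ℂ ∧ V i * C i = C i * V i)
    (p q : ℝ) (hq : 1 ≤ q) (hqp : q ≤ p) :
    schattenNorm p ((List.ofFn fun i => mpow (C i) ((1 / p : ℝ) : ℂ) * V i).prod) ^ p ≤
    sSup {x : ℝ | ∃ W : Fin L → Matrix n n ℂ,
        (∀ i, W i ∈ Matrix.unitaryGroup n ℂ ∧ W i * C i = C i * W i) ∧
        x = schattenNorm q
          ((List.ofFn fun i => mpow (C i) ((1 / q : ℝ) : ℂ) * W i).prod) ^ q} := by
  open scoped Matrix.Norms.L2Operator in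
  have hq0 : 0 < q := by linarith
  have hp0 : 0 < p := by linarith
  choose K hK using fun i => norm_mpow_le (hC i)
  have hdivre : ∀ z : ℂ, (z / q).re = z.re / q := fun z => Complex.div_ofReal_re z q
  have hstrip : ∀ z : ℂ, 0 ≤ z.re → z.re ≤ 1 → 0 ≤ (z / q).re ∧ (z / q).re ≤ 1 := by
    intro z h0 h1
    rw [hdivre]
    exact ⟨by positivity, (div_le_one hq0).2 (h1.trans hq)⟩
  have hbdd : BddAbove {x : ℝ | ∃ W : Fin L → Matrix n n ℂ,
      (∀ i, W i ∈ Matrix.unitaryGroup n ℂ ∧ W i * C i = C i * W i) ∧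
      x = schattenNorm q
        ((List.ofFn fun i => mpow (C i) ((1 / q : ℝ) : ℂ) * W i).prod) ^ q} := by
    refine ⟨Fintype.card n * (∏ i, K i) ^ q, ?_⟩
    rintro _ ⟨W, hW, rfl⟩
    refine (schattenNorm_rpow_le_card_mul _ hq).trans ?_
    refine mul_le_mul_of_nonneg_left (Real.rpow_le_rpow (norm_nonneg _) ?_ hq0.le)
      (Nat.cast_nonneg _)
    refine norm_list_ofFn_prod_le fun i => (norm_mul_unitary_le (hW i).1 _).trans (hK i _ ?_ ?_)
    · rw [Complex.ofReal_re]; positivity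
    · rw [Complex.ofReal_re]; exact (div_le_one hq0).2 hq
  have key := schattenNorm_rpow_le_of_strip
    (G := fun z => (List.ofFn fun i => mpow (C i) (z / q) * V i).prod) (K := ∏ i, K i)
    ?_ ?_ ?_ hq hqp (fun z hz => le_csSup hbdd ?_) ((schattenNorm_rpow_nonneg _ hq).trans
      (le_csSup hbdd ⟨V, hV, rfl⟩))
  · have hexp : ((q / p : ℝ) : ℂ) / q = ((1 / p : ℝ) : ℂ) := by
      have : (p : ℂ) ≠ 0 := by exact_mod_cast hp0.ne'
      have : (q : ℂ) ≠ 0 := by exact_mod_cast hq0.ne'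
      push_cast
      field_simp
    simpa only [hexp] using key
  · exact differentiable_list_ofFn_prod fun i =>
      ((differentiable_mpow (hC i)).comp (by fun_prop)).mul (differentiable_const (V i))
  · intro z h0 h1
    exact norm_list_ofFn_prod_le fun i => (norm_mul_unitary_le (hV i).1 _).trans
      (hK i _ (hstrip z h0 h1).1 (hstrip z h0 h1).2)
  · intro z h0
    have h := norm_list_ofFn_prod_le (f := fun i => mpow (C i) (z / q) * V i) (K := fun _ => 1)
      fun i => (norm_mul_unitary_le (hV i).1 _).trans
        (norm_mpow_le_one (hC i) (by rw [hdivre, h0, zero_div]))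
    simpa using h
  · choose U hU hUC hUz using fun i => exists_unitary_mpow_eq (hC i) (z / q)
    refine ⟨fun i => U i * V i, fun i => ⟨mul_mem (hU i) (hV i).1, ?_⟩, ?_⟩
    · rw [mul_assoc, (hV i).2, ← mul_assoc, hUC i, mul_assoc]
    · have hre : (z / q).re = 1 / q := by rw [hdivre, hz]
      simp only [hUz, hre, mul_assoc]
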